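/- Fix an integer d ≥ 2, let L_d = {0, 1/(d−1), …, 1}, and let m_d : L_d^3 → L_d^3 be defined by the first applicable of the following rules: i) (x₁,x₃,x₂) if x₁ = 0 and x₂ ≠ x₃; ii) (x₁,x₁+x₃,1−x₁) if x₁ > 0, x₂ = 1 and x₁+x₃ < 1; iii) (x₁,1,x₂−x₁) if 0 < x₁ ≤ x₂ < 1 and x₃ = 1−x₁; iv) (x₁,x₁+x₂−1,1−x₁) if x₁ < 1, x₂ < 1, x₃ = 0 and x₁+x₂ > 1; v) (x₁,x₂+x₃,0) if 0 < x₂ < x₁ < 1 and x₃ = 1−x₁; vi) (x₁,x₃,x₂) if 0 < x₁, x₂ > 0, x₃ = 0 and x₁+x₂ ≤ 1; vii) (x₁,x₃,x₂) if 0 < x₁, x₂ = 0, x₃ > 0 and x₁+x₃ ≤ 1; viii) (x₁,x₂,x₃) otherwise. Then m_d realizes in its configurations the MV-connectives: for all a, b ∈ L_d, (1) the second component of m_d(a,1,b) equals a ⊕ b = min(1, a+b), and (2) the second component of m_d(a,b,0) equals a ⊙ b = max(0, a+b−1). -/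

import Mathlib

/-- The set of truth values `L_d = {0, 1/(d-1), …, 1}` as a finite set of reals. -/
noncomputable def Ld (d : ℕ) : Finset ℝ :=
  (Finset.range d).image (fun k : ℕ => (k : ℝ) / ((d : ℝ) - 1))

/-- The gate `m_d`, defined by the first applicable of rules i) – viii). -/
noncomputable def md (x : ℝ × ℝ × ℝ) : ℝ × ℝ × ℝ :=
  let x₁ := x.1; let x₂ := x.2.1; let x₃ := x.2.2
  if x₁ = 0 ∧ x₂ ≠ x₃ then (x₁, x₃, x₂)                                           -- i)
  else if 0 < x₁ ∧ x₂ = 1 ∧ x₁ + x₃ < 1 then (x₁, x₁ + x₃, 1 - x₁)                -- ii)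
  else if 0 < x₁ ∧ x₁ ≤ x₂ ∧ x₂ < 1 ∧ x₃ = 1 - x₁ then (x₁, 1, x₂ - x₁)           -- iii)
  else if x₁ < 1 ∧ x₂ < 1 ∧ x₃ = 0 ∧ 1 < x₁ + x₂ then (x₁, x₁ + x₂ - 1, 1 - x₁)   -- iv)
  else if 0 < x₂ ∧ x₂ < x₁ ∧ x₁ < 1 ∧ x₃ = 1 - x₁ then (x₁, x₂ + x₃, 0)           -- v)
  else if 0 < x₁ ∧ 0 < x₂ ∧ x₃ = 0 ∧ x₁ + x₂ ≤ 1 then (x₁, x₃, x₂)                -- vi)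
  else if 0 < x₁ ∧ x₂ = 0 ∧ 0 < x₃ ∧ x₁ + x₃ ≤ 1 then (x₁, x₃, x₂)                -- vii)
  else (x₁, x₂, x₃)                                                                -- viii)

theorem mem_Icc_of_mem_Ld {d : ℕ} (hd : 2 ≤ d) {a : ℝ} (ha : a ∈ Ld d) : a ∈ Set.Icc 0 1 := by
  obtain ⟨k, hk, rfl⟩ := Finset.mem_image.mp ha
  have hd' : (2 : ℝ) ≤ d := by exact_mod_cast hd
  have hk' : (k : ℝ) + 1 ≤ d := by exact_mod_cast Finset.mem_range.mp hk
  refine ⟨div_nonneg (by positivity) (by linarith), ?_⟩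
  rw [div_le_one (by linarith)]
  linarith

theorem md_one_eq_min {a b : ℝ} (ha : a ∈ Set.Icc 0 1) (hb : b ∈ Set.Icc 0 1) :
    (md (a, 1, b)).2.1 = min 1 (a + b) := by
  obtain ⟨ha₀, ha₁⟩ := ha
  obtain ⟨hb₀, hb₁⟩ := hb
  simp only [md]
  grind

theorem md_zero_eq_max {a b : ℝ} (ha : a ∈ Set.Icc 0 1) (hb : b ∈ Set.Icc 0 1) :
    (md (a, b, 0)).2.1 = max 0 (a + b - 1) := by
  obtain ⟨ha₀, ha₁⟩ := ha
  obtain ⟨hb₀, hb₁⟩ := hb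
  refine (max_eq_iff.2 ?_).symm
  simp only [md]
  split_ifs <;> grind

theorem stmt_19 (d : ℕ) (hd : 2 ≤ d) :
    (∀ a ∈ Ld d, ∀ b ∈ Ld d, (md (a, 1, b)).2.1 = min 1 (a + b)) ∧
    (∀ a ∈ Ld d, ∀ b ∈ Ld d, (md (a, b, 0)).2.1 = max 0 (a + b - 1)) :=
  ⟨fun _ ha _ hb => md_one_eq_min (mem_Icc_of_mem_Ld hd ha) (mem_Icc_of_mem_Ld hd hb),
    fun _ ha _ hb => md_zero_eq_max (mem_Icc_of_mem_Ld hd ha) (mem_Icc_of_mem_Ld hd hb)⟩
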